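/- arXiv:1310.1180 — 8 statements merged into one kernel-verified Lean document; each statement's English description precedes it below -/
import Mathlib

section
/- Let x₀ ∈ ℝ, let X be a set of sequences x : ℕ → ℝ with x(0) = x₀ (the attainable paths), and let v : ℝ → ℝ → ℕ → ℝ. Suppose that for each horizon T ∈ ℕ there is a sequence x*_T : ℕ → ℝ with x*_T(t) = 0 for all t ≥ T+1 which is optimal for the finite-horizon problem, i.e. for every x ∈ X, Σ_{t=0}^{T} v(x̃^T(t), x̃^T(t+1), t) ≤ Σ_{t=0}^{T} v(x*_T(t), x*_T(t+1), t). Suppose further that the pointwise limit x°(t) = lim_{T→∞} x*_T(t) exists for every t, and that lim_{T→∞} Σ_{t=0}^{T} ( v(x*_T(t), x*_T(t+1), t) − v(x̃°^T(t), x̃°^T(t+1), t) ) = 0, where x̃°^T denotes the modified path of x°. Then no attainable path overtakes x° in the modified sense: for every x₁ ∈ X, liminf_{T→∞} Σ_{t=0}^{T} ( v(x̃₁^T(t), x̃₁^T(t+1), t) − v(x̃°^T(t), x̃°^T(t+1), t) ) ≤ 0. -/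
open Filter Finset

/-- The modified ("eating up") path: equal to `x` up to time `T`, and `0` afterwards. -/
def modPath (x : ℕ → ℝ) (T : ℕ) : ℕ → ℝ := fun t => if t ≤ T then x t else 0

/-- Theorem 1: if for each horizon `T` the path `xT T` (vanishing after time `T`)
is optimal for the `T`-horizon problem among the modified attainable paths, the
pointwise limit `xo` of the `xT T` exists, and the value gap between `xT T` and
the modified path of `xo` tends to `0`, then no attainable path overtakes `xo`
in the modified sense. -/
theorem limit_path_weakly_maximal (x₀ : ℝ) (X : Set (ℕ → ℝ))
    (hX : ∀ x ∈ X, x 0 = x₀)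
    (v : ℝ → ℝ → ℕ → ℝ)
    (xT : ℕ → ℕ → ℝ)
    (hT0 : ∀ T t, T + 1 ≤ t → xT T t = 0)
    (hTopt : ∀ T : ℕ, ∀ x ∈ X,
      ∑ t ∈ range (T + 1), v (modPath x T t) (modPath x T (t + 1)) t
        ≤ ∑ t ∈ range (T + 1), v (xT T t) (xT T (t + 1)) t)
    (xo : ℕ → ℝ)
    (hxo : ∀ t, Tendsto (fun T => xT T t) atTop (nhds (xo t)))
    (hgap : Tendsto
      (fun T => ∑ t ∈ range (T + 1),
        (v (xT T t) (xT T (t + 1)) t - v (modPath xo T t) (modPath xo T (t + 1)) t))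
      atTop (nhds 0)) :
    ∀ x₁ ∈ X,
      liminf (fun T => ((∑ t ∈ range (T + 1),
        (v (modPath x₁ T t) (modPath x₁ T (t + 1)) t
          - v (modPath xo T t) (modPath xo T (t + 1)) t) : ℝ) : EReal)) atTop
        ≤ (0 : EReal) := by
  intro x₁ hx₁
  have hlim := (continuous_coe_real_ereal.tendsto 0).comp hgap
  rw [← EReal.coe_zero, ← hlim.liminf_eq]
  refine liminf_le_liminf (Eventually.of_forall fun T => ?_)
  refine EReal.coe_le_coe_iff.mpr ?_
  simp only [sum_sub_distrib]
  exact sub_le_sub_right (hTopt T x₁ hx₁) _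
end

section
/- Let δ > 0 and for each T ∈ ℕ let f_T : (−δ, δ) → ℝ satisfy f_T(0) = 0 and be differentiable at 0. Suppose (i) liminf_{T→∞} f_T(ε) ≤ 0 for every ε ∈ (−δ, δ), and (ii) there is a function h : (−δ, δ) \ {0} → ℝ such that ε ↦ f_T(ε)/ε converges to h uniformly on (−δ, δ) \ {0} as T → ∞. Then lim_{T→∞} f_T′(0) exists and equals 0. -/
open Filter Set

/-- If the real sequence `u` converges to `a` and its liminf, taken in the extended reals, is at
most `0`, then `a ≤ 0`. -/
theorem nonpos_of_tendsto_of_liminf_coe_nonpos {u : ℕ → ℝ} {a : ℝ}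
    (hu : Tendsto u atTop (nhds a))
    (hlim : liminf (fun n => ((u n : ℝ) : EReal)) atTop ≤ (0 : EReal)) : a ≤ 0 := by
  have hu' : Tendsto (fun n => ((u n : ℝ) : EReal)) atTop (nhds (a : EReal)) :=
    (continuous_coe_real_ereal.tendsto a).comp hu
  rw [hu'.liminf_eq] at hlim
  exact_mod_cast hlim

/-- At a function vanishing at `0`, difference quotients at `0` are `g x / x`. -/
theorem HasDerivAt.tendsto_div_of_map_zero {g : ℝ → ℝ} {g' : ℝ} (hg : HasDerivAt g g' 0)
    (hg0 : g 0 = 0) : Tendsto (fun x => g x / x) (nhdsWithin 0 {0}ᶜ) (nhds g') := by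
  refine (hasDerivAt_iff_tendsto_slope.mp hg).congr fun x => ?_
  simp [slope_def_field, hg0]

/-- The analytic core of Theorem 2: if each `f T` vanishes at `0`, is differentiable
at `0` with derivative `d T`, the liminf of `T ↦ f T ε` is nonpositive for every
`ε ∈ (-δ, δ)`, and `ε ↦ f T ε / ε` converges uniformly on `(-δ, δ) \ {0}` to some
function `h`, then `d T → 0`. -/
theorem deriv_tendsto_zero_of_liminf_nonpos (δ : ℝ) (hδ : 0 < δ)
    (f : ℕ → ℝ → ℝ) (d : ℕ → ℝ)
    (hf0 : ∀ T, f T 0 = 0)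
    (hfd : ∀ T, HasDerivAt (f T) (d T) 0)
    (hliminf : ∀ ε ∈ Ioo (-δ) δ,
      liminf (fun T => ((f T ε : ℝ) : EReal)) atTop ≤ (0 : EReal))
    (h : ℝ → ℝ)
    (hunif : ∀ ε' > (0 : ℝ), ∃ T₀ : ℕ, ∀ T > T₀, ∀ ε ∈ Ioo (-δ) δ, ε ≠ 0 →
      |f T ε / ε - h ε| < ε') :
    Tendsto d atTop (nhds 0) := by
  have hmul : ∀ ε ∈ Ioo (-δ) δ, ε ≠ 0 → ε * h ε ≤ 0 := by
    intro ε hε hε0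
    have hquot : Tendsto (fun T => f T ε / ε) atTop (nhds (h ε)) := by
      rw [Metric.tendsto_atTop]
      intro r hr
      obtain ⟨T₀, hT₀⟩ := hunif r hr
      exact ⟨T₀ + 1, fun T hT => by
        rw [Real.dist_eq]
        exact hT₀ T (by omega) ε hε hε0⟩
    refine nonpos_of_tendsto_of_liminf_coe_nonpos ?_ (hliminf ε hε)
    exact (hquot.const_mul ε).congr fun T => mul_div_cancel₀ _ hε0
  rw [Metric.tendsto_atTop]
  intro r hr
  obtain ⟨T₀, hT₀⟩ := hunif (r / 2) (half_pos hr)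
  refine ⟨T₀ + 1, fun T hT => ?_⟩
  have hslope := (hfd T).tendsto_div_of_map_zero (hf0 T)
  have hupper : d T ≤ r / 2 := by
    refine le_of_tendsto (hslope.mono_left (nhdsGT_le_nhdsNE 0)) ?_
    filter_upwards [Ioo_mem_nhdsGT hδ] with ε hε
    have hmem : ε ∈ Ioo (-δ) δ := ⟨by linarith [hε.1], hε.2⟩
    have hbound := (abs_lt.mp (hT₀ T (by omega) ε hmem hε.1.ne')).2
    linarith [nonpos_of_mul_nonpos_right (hmul ε hmem hε.1.ne') hε.1]
  have hlower : -(r / 2) ≤ d T := by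
    refine ge_of_tendsto (hslope.mono_left (nhdsLT_le_nhdsNE 0)) ?_
    filter_upwards [Ioo_mem_nhdsLT (neg_lt_zero.mpr hδ)] with ε hε
    have hmem : ε ∈ Ioo (-δ) δ := ⟨hε.1, by linarith [hε.2]⟩
    have hbound := (abs_lt.mp (hT₀ T (by omega) ε hmem hε.2.ne)).1
    have hnonneg : 0 ≤ h ε := by
      by_contra! hneg
      exact (hmul ε hmem hε.2.ne).not_gt (mul_pos_of_neg_of_neg hε.2 hneg)
    linarith
  rw [Real.dist_eq, sub_zero, abs_lt]
  constructor <;> linarith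
end

section
/- Let x₀ ∈ ℝ and v : ℝ → ℝ → ℕ → ℝ be such that for each t ∈ ℕ the map (x, y) ↦ v(x, y, t) is concave on ℝ² and continuously differentiable, with partial derivatives v₁ (with respect to the first argument) and v₂ (with respect to the second argument), and such that for each t and each x the map y ↦ v₁(x, y, t) is nondecreasing (i.e. v₁₂ ≥ 0). Let x* : ℕ → ℝ satisfy x*(0) = x₀, x*(t) ≥ 0 for all t, the Euler equation v₂(x*(t), x*(t+1), t) + v₁(x*(t+1), x*(t+2), t+1) = 0 for all t ∈ ℕ, and the transversality condition limsup_{T→∞} ( v₂(x*(T−1), x*(T), T−1) + v₁(x*(T), 0, T) ) · x*(T) ≥ 0. Then x* is optimal in the modified overtaking sense: for every sequence x : ℕ → ℝ with x(0) = x₀ and x(t) ≥ 0 for all t, liminf_{T→∞} [ Σ_{t=0}^{T−1} ( v(x(t), x(t+1), t) − v(x*(t), x*(t+1), t) ) + v(x(T), 0, T) − v(x*(T), 0, T) ] ≤ 0. -/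
open Filter Finset

/-- The supergradient inequality for a concave function of two real variables which has both
partial derivatives at a point (joint differentiability is not needed). -/
theorem ConcaveOn.sub_le_of_hasDerivAt_partial {f : ℝ → ℝ → ℝ} {a b f₁ f₂ : ℝ}
    (hf : ConcaveOn ℝ Set.univ (fun p : ℝ × ℝ => f p.1 p.2))
    (h₁ : HasDerivAt (fun x => f x b) f₁ a) (h₂ : HasDerivAt (fun y => f a y) f₂ b) (x y : ℝ) :
    f x y - f a b ≤ f₁ * (x - a) + f₂ * (y - b) := by
  have hd : HasDerivAt (fun s : ℝ => s * (f a b - f x y)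
      - (1 / 2) * f (a - s * (2 * (x - a))) b - (1 / 2) * f a (b - s * (2 * (y - b))))
      (f a b - f x y + f₁ * (x - a) + f₂ * (y - b)) 0 := by
    have e₁ : HasDerivAt (fun s : ℝ => a - s * (2 * (x - a))) (-(1 * (2 * (x - a)))) 0 :=
      ((hasDerivAt_id (0 : ℝ)).mul_const _).const_sub a
    have e₂ : HasDerivAt (fun s : ℝ => b - s * (2 * (y - b))) (-(1 * (2 * (y - b)))) 0 :=
      ((hasDerivAt_id (0 : ℝ)).mul_const _).const_sub b
    have k₁ := (HasDerivAt.comp_of_eq (0 : ℝ) h₁ e₁ (by simp)).const_mul (1 / 2)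
    have k₂ := (HasDerivAt.comp_of_eq (0 : ℝ) h₂ e₂ (by simp)).const_mul (1 / 2)
    refine ((((hasDerivAt_id (0 : ℝ)).mul_const (f a b - f x y)).sub k₁).sub k₂).congr_deriv ?_
    ring
  have key : ∀ s : ℝ, 0 < s → 0 ≤ s * (f a b - f x y) + f a b
      - (1 / 2) * f (a - s * (2 * (x - a))) b - (1 / 2) * f a (b - s * (2 * (y - b))) := by
    intro s hs
    have hs' : (1 + s) ≠ 0 := by positivity
    have c₁ := hf.2 (Set.mem_univ (a - s * (2 * (x - a)), b))
      (Set.mem_univ (a, b - s * (2 * (y - b))))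
      (show (0 : ℝ) ≤ 1 / 2 by norm_num) (show (0 : ℝ) ≤ 1 / 2 by norm_num) (by norm_num)
    have c₂ := hf.2 (Set.mem_univ (x, y)) (Set.mem_univ (a - s * (x - a), b - s * (y - b)))
      (show 0 ≤ s / (1 + s) by positivity) (show 0 ≤ 1 / (1 + s) by positivity)
      (by field_simp; ring)
    simp only [smul_eq_mul, Prod.smul_mk, Prod.mk_add_mk] at c₁ c₂
    rw [show 1 / 2 * (a - s * (2 * (x - a))) + 1 / 2 * a = a - s * (x - a) by ring,
      show 1 / 2 * b + 1 / 2 * (b - s * (2 * (y - b))) = b - s * (y - b) by ring] at c₁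
    rw [show s / (1 + s) * x + 1 / (1 + s) * (a - s * (x - a)) = a by field_simp; ring,
      show s / (1 + s) * y + 1 / (1 + s) * (b - s * (y - b)) = b by field_simp; ring,
      div_mul_eq_mul_div, div_mul_eq_mul_div, ← add_div, div_le_iff₀ (by positivity)] at c₂
    linarith
  have hlim := hd.tendsto_slope_zero_right
  have : 0 ≤ f a b - f x y + f₁ * (x - a) + f₂ * (y - b) := by
    refine ge_of_tendsto hlim ?_
    filter_upwards [self_mem_nhdsWithin] with s hs
    have hs' : 0 < s := hs
    refine smul_nonneg (inv_nonneg.2 hs'.le) ?_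
    have := key s hs'
    simp only [zero_add, zero_mul, sub_zero]
    linarith
  linarith

/-- Theorem 3 (sufficiency): under concavity, continuous differentiability
(with partial derivatives `v1`, `v2`), and supermodularity (`v₁₂ ≥ 0`, i.e.
`y ↦ v1 x y t` nondecreasing), a nonnegative path `x*` starting at `x₀` that
satisfies the Euler equation and the transversality condition
`limsup_{T→∞} (v2(x*(T-1), x*(T), T-1) + v1(x*(T), 0, T)) · x*(T) ≥ 0`
is optimal in the modified overtaking sense. -/
theorem euler_tvc_sufficient (x₀ : ℝ) (v v1 v2 : ℝ → ℝ → ℕ → ℝ)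
    (hconc : ∀ t : ℕ, ConcaveOn ℝ Set.univ (fun p : ℝ × ℝ => v p.1 p.2 t))
    (hv1 : ∀ (x y : ℝ) (t : ℕ), HasDerivAt (fun x' => v x' y t) (v1 x y t) x)
    (hv2 : ∀ (x y : ℝ) (t : ℕ), HasDerivAt (fun y' => v x y' t) (v2 x y t) y)
    (hv1cont : ∀ t : ℕ, Continuous (fun p : ℝ × ℝ => v1 p.1 p.2 t))
    (hv2cont : ∀ t : ℕ, Continuous (fun p : ℝ × ℝ => v2 p.1 p.2 t))
    (hmono : ∀ (t : ℕ) (x : ℝ), Monotone (fun y => v1 x y t))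
    (xs : ℕ → ℝ) (hxs0 : xs 0 = x₀) (hxsnn : ∀ t, 0 ≤ xs t)
    (heuler : ∀ t : ℕ,
      v2 (xs t) (xs (t + 1)) t + v1 (xs (t + 1)) (xs (t + 2)) (t + 1) = 0)
    (htvc : (0 : EReal) ≤ limsup (fun T : ℕ =>
      (((v2 (xs (T - 1)) (xs T) (T - 1) + v1 (xs T) 0 T) * xs T : ℝ) : EReal)) atTop) :
    ∀ x : ℕ → ℝ, x 0 = x₀ → (∀ t, 0 ≤ x t) →
      liminf (fun T : ℕ =>
        (((∑ t ∈ range T, (v (x t) (x (t + 1)) t - v (xs t) (xs (t + 1)) t))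
          + v (x T) 0 T - v (xs T) 0 T : ℝ) : EReal)) atTop ≤ (0 : EReal) := by
  intro x hx0 hxnn
  have hgrad (t : ℕ) (a b c d : ℝ) : v c d t - v a b t ≤ v1 a b t * (c - a) + v2 a b t * (d - b) :=
    ConcaveOn.sub_le_of_hasDerivAt_partial (f := fun x y => v x y t) (hconc t)
      (hv1 a b t) (hv2 a b t) c d
  have hsum (n : ℕ) : ∑ t ∈ range (n + 1), (v (x t) (x (t + 1)) t - v (xs t) (xs (t + 1)) t)
      ≤ v2 (xs n) (xs (n + 1)) n * (x (n + 1) - xs (n + 1)) := by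
    induction n with
    | zero =>
      have := hgrad 0 (xs 0) (xs 1) (x 0) (x 1)
      simpa [hx0, hxs0] using this
    | succ n ih =>
      rw [sum_range_succ]
      have h := hgrad (n + 1) (xs (n + 1)) (xs (n + 2)) (x (n + 1)) (x (n + 2))
      rw [← neg_eq_iff_add_eq_zero.2 (heuler n)] at h
      linarith
  have hbound : ∀ᶠ T : ℕ in atTop,
      (((∑ t ∈ range T, (v (x t) (x (t + 1)) t - v (xs t) (xs (t + 1)) t))
          + v (x T) 0 T - v (xs T) 0 T : ℝ) : EReal) ≤
        -(((v2 (xs (T - 1)) (xs T) (T - 1) + v1 (xs T) 0 T) * xs T : ℝ) : EReal) := by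
    filter_upwards [eventually_ge_atTop 1] with T hT
    obtain ⟨n, rfl⟩ := Nat.exists_eq_add_of_le' hT
    rw [← EReal.coe_neg, EReal.coe_le_coe_iff, Nat.add_sub_cancel]
    have hterm := hgrad (n + 1) (xs (n + 1)) 0 (x (n + 1)) 0
    have hcoef : v2 (xs n) (xs (n + 1)) n + v1 (xs (n + 1)) 0 (n + 1) ≤ 0 := by
      have := hmono (n + 1) (xs (n + 1)) (hxsnn (n + 2))
      have := heuler n
      dsimp only at *
      linarith
    linarith [hsum n, mul_nonpos_of_nonpos_of_nonneg hcoef (hxnn (n + 1))]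
  refine (liminf_le_liminf hbound).trans ?_
  have hneg := EReal.liminf_neg (f := (atTop : Filter ℕ)) (v := fun T : ℕ =>
    (((v2 (xs (T - 1)) (xs T) (T - 1) + v1 (xs T) 0 T) * xs T : ℝ) : EReal))
  exact hneg.trans_le (by simpa using EReal.neg_le_neg_iff.2 htvc)
end

section
/- Let α ∈ (0, 1), β ∈ (0, 1], and k₀ > 0 (so that 0 < αβ < 1). For each T ∈ ℕ define the finite sequence k_T(0), …, k_T(T+1) by k_T(0) = k₀ and k_T(t+1) = αβ · (1 − (αβ)^{T−t}) / (1 − (αβ)^{T−t+1}) · k_T(t)^α for 0 ≤ t ≤ T. Then k_T(T+1) = 0 and, for each fixed t ∈ ℕ, lim_{T→∞} k_T(t) = (αβ)^{(1−α^t)/(1−α)} · k₀^{α^t}. -/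
open Filter

/-- The finite-horizon saving-rate factor tends to `1` as the remaining horizon grows. -/
theorem tendsto_one_sub_pow_div_one_sub_pow_succ {a : ℝ} (h₀ : 0 ≤ a) (h₁ : a < 1) :
    Tendsto (fun n : ℕ => (1 - a ^ n) / (1 - a ^ (n + 1))) atTop (nhds 1) := by
  have h : Tendsto (fun n : ℕ => 1 - a ^ n) atTop (nhds 1) := by
    simpa using (tendsto_pow_atTop_nhds_zero_of_lt_one h₀ h₁).const_sub 1
  simpa [Pi.div_def] using h.div (h.comp (tendsto_add_atTop_nat 1)) one_ne_zero

/-- The closed form of the infinite-horizon path satisfies `x (t + 1) = a * x t ^ α`. -/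
theorem mul_closed_form_rpow {a x α : ℝ} (ha : 0 < a) (hx : 0 < x) (hα : α ≠ 1) (t : ℕ) :
    a * (a ^ ((1 - α ^ t) / (1 - α)) * x ^ (α ^ t)) ^ α =
      a ^ ((1 - α ^ (t + 1)) / (1 - α)) * x ^ (α ^ (t + 1)) := by
  have hα' : 1 - α ≠ 0 := sub_ne_zero.mpr hα.symm
  have he : (1 - α ^ (t + 1)) / (1 - α) = 1 + (1 - α ^ t) / (1 - α) * α := by
    field_simp
    ring
  rw [he, Real.rpow_add ha, Real.rpow_one, Real.mul_rpow (by positivity) (by positivity),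
    ← Real.rpow_mul ha.le, ← Real.rpow_mul hx.le, ← pow_succ, mul_assoc]

/-- Section 4.1: the finite-horizon optimal capital paths `k T` of the one-sector
growth model, given by the backward recursion
`k T (t+1) = αβ (1-(αβ)^{T-t}) / (1-(αβ)^{T-t+1}) · (k T t)^α`,
satisfy `k T (T+1) = 0` and converge pointwise, as `T → ∞`, to
`(αβ)^{(1-α^t)/(1-α)} · k₀^{α^t}`. -/
theorem growth_capital_path_limit (α β k₀ : ℝ)
    (hα : α ∈ Set.Ioo (0 : ℝ) 1) (hβ : β ∈ Set.Ioc (0 : ℝ) 1) (hk₀ : 0 < k₀)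
    (k : ℕ → ℕ → ℝ)
    (hk0 : ∀ T : ℕ, k T 0 = k₀)
    (hkrec : ∀ T t : ℕ, t ≤ T →
      k T (t + 1) = α * β * ((1 - (α * β) ^ (T - t)) / (1 - (α * β) ^ (T - t + 1)))
        * (k T t) ^ α) :
    (∀ T : ℕ, k T (T + 1) = 0) ∧
    ∀ t : ℕ, Tendsto (fun T => k T t) atTop
      (nhds ((α * β) ^ ((1 - α ^ t) / (1 - α)) * k₀ ^ (α ^ t))) := by
  have ha : 0 < α * β := mul_pos hα.1 hβ.1
  have ha' : α * β < 1 := (mul_le_of_le_one_right hα.1.le hβ.2).trans_lt hα.2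
  refine ⟨fun T => by simp [hkrec T T le_rfl], fun t => ?_⟩
  induction t with
  | zero => simp [hk0]
  | succ t ih =>
    rw [← mul_closed_form_rpow ha hk₀ hα.2.ne t]
    have hfactor := (tendsto_one_sub_pow_div_one_sub_pow_succ ha.le ha').comp
      (tendsto_sub_atTop_nat t)
    have hlim := (hfactor.const_mul (α * β)).mul (ih.rpow_const (Or.inr hα.1.le))
    rw [mul_one] at hlim
    refine hlim.congr' ?_
    filter_upwards [eventually_ge_atTop t] with T hT
    exact (hkrec T t hT).symm
end

section
/- Let α ∈ (0, 1), β ∈ (0, 1], and k₀ > 0. For each T ∈ ℕ define k_T(0), …, k_T(T+1) by k_T(0) = k₀ and k_T(t+1) = αβ · (1 − (αβ)^{T−t}) / (1 − (αβ)^{T−t+1}) · k_T(t)^α for 0 ≤ t ≤ T. Then for each fixed t ∈ ℕ, the consumption c_T(t) = k_T(t)^α − k_T(t+1) satisfies lim_{T→∞} c_T(t) = (1 − αβ) · (αβ)^{α(1−α^t)/(1−α)} · k₀^{α^{t+1}}. -/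
open Filter

/-- The growth factor of the finite-horizon capital path tends to `a = αβ`. -/
theorem tendsto_growth_factor {a : ℝ} (ha0 : 0 ≤ a) (ha1 : a < 1) (t : ℕ) :
    Tendsto (fun T : ℕ => a * ((1 - a ^ (T - t)) / (1 - a ^ (T - t + 1)))) atTop (nhds a) := by
  have hpow := tendsto_pow_atTop_nhds_zero_of_lt_one ha0 ha1
  have hsub : Tendsto (fun T : ℕ => T - t) atTop atTop := tendsto_sub_atTop_nat t
  have hnum := (hpow.comp hsub).const_sub 1
  have hden := (hpow.comp ((tendsto_add_atTop_nat 1).comp hsub)).const_sub 1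
  simpa [Function.comp_def] using (hnum.div hden (by norm_num)).const_mul a

/-- The limiting capital path `a^{(1-α^t)/(1-α)} · k₀^{α^t}` solves `x(t+1) = a · x(t)^α`. -/
theorem limit_capital_succ {α a k₀ : ℝ} (hα : α ≠ 1) (ha : 0 < a) (hk₀ : 0 < k₀) (t : ℕ) :
    a * (a ^ ((1 - α ^ t) / (1 - α)) * k₀ ^ (α ^ t)) ^ α =
      a ^ ((1 - α ^ (t + 1)) / (1 - α)) * k₀ ^ (α ^ (t + 1)) := by
  have hne : 1 - α ≠ 0 := sub_ne_zero.mpr hα.symm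
  rw [Real.mul_rpow (by positivity) (by positivity), ← Real.rpow_mul ha.le,
    ← Real.rpow_mul hk₀.le, ← mul_assoc, pow_succ]
  nth_rewrite 1 [← Real.rpow_one a]
  rw [← Real.rpow_add ha]
  congr 2
  field_simp
  ring

/-- Section 4.1: along the finite-horizon optimal capital paths `k T` of the
one-sector growth model, the consumption `c T t = (k T t)^α - k T (t+1)`
converges, as `T → ∞`, to `(1-αβ) · (αβ)^{α(1-α^t)/(1-α)} · k₀^{α^{t+1}}`. -/
theorem growth_consumption_limit (α β k₀ : ℝ)
    (hα : α ∈ Set.Ioo (0 : ℝ) 1) (hβ : β ∈ Set.Ioc (0 : ℝ) 1) (hk₀ : 0 < k₀)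
    (k : ℕ → ℕ → ℝ)
    (hk0 : ∀ T : ℕ, k T 0 = k₀)
    (hkrec : ∀ T t : ℕ, t ≤ T →
      k T (t + 1) = α * β * ((1 - (α * β) ^ (T - t)) / (1 - (α * β) ^ (T - t + 1)))
        * (k T t) ^ α) :
    ∀ t : ℕ, Tendsto (fun T => (k T t) ^ α - k T (t + 1)) atTop
      (nhds ((1 - α * β) * (α * β) ^ (α * (1 - α ^ t) / (1 - α)) * k₀ ^ (α ^ (t + 1)))) := by
  obtain ⟨hα0, hα1⟩ := hα
  obtain ⟨hβ0, hβ1⟩ := hβ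
  have ha0 : 0 < α * β := mul_pos hα0 hβ0
  have ha1 : α * β < 1 := (mul_le_of_le_one_right hα0.le hβ1).trans_lt hα1
  have hpow {t : ℕ} {l : ℝ} (h : Tendsto (fun T => k T t) atTop (nhds l)) :
      Tendsto (fun T => k T t ^ α) atTop (nhds (l ^ α)) :=
    h.rpow_const (Or.inr hα0.le)
  have hstep {t : ℕ} {l : ℝ} (h : Tendsto (fun T => k T t) atTop (nhds l)) :
      Tendsto (fun T => k T (t + 1)) atTop (nhds (α * β * l ^ α)) := by
    refine ((tendsto_growth_factor ha0.le ha1 t).mul (hpow h)).congr' ?_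
    filter_upwards [eventually_ge_atTop t] with T hT
    exact (hkrec T t hT).symm
  have hlim (t : ℕ) : Tendsto (fun T => k T t) atTop
      (nhds ((α * β) ^ ((1 - α ^ t) / (1 - α)) * k₀ ^ (α ^ t))) := by
    induction t with
    | zero => simp [hk0]
    | succ t ih =>
      rw [← limit_capital_succ hα1.ne ha0 hk₀]
      exact hstep ih
  intro t
  convert (hpow (hlim t)).sub (hstep (hlim t)) using 2
  rw [Real.mul_rpow (x := (α * β) ^ ((1 - α ^ t) / (1 - α))) (by positivity) (by positivity),
    ← Real.rpow_mul ha0.le, ← Real.rpow_mul hk₀.le, ← pow_succ,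
    show α * (1 - α ^ t) / (1 - α) = (1 - α ^ t) / (1 - α) * α by ring]
  ring
end

section
/- Let α ∈ (0, 1), β ∈ (0, 1], and k₀ > 0, and define k°(t) = (αβ)^{(1−α^t)/(1−α)} · k₀^{α^t} for t ∈ ℕ. Then lim_{t→∞} k°(t) = (αβ)^{1/(1−α)}, and k* = (αβ)^{1/(1−α)} is the unique k > 0 satisfying k = αβ · k^α. -/
open Filter

/-- For `c > 0` and `a ≠ 1`, the equation `x = c * x ^ a` has exactly one positive solution. -/
theorem Real.eq_mul_rpow_self_iff {c a x : ℝ} (hc : 0 < c) (ha : a ≠ 1) (hx : 0 < x) :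
    x = c * x ^ a ↔ x = c ^ (1 / (1 - a)) := by
  rw [one_div, Real.eq_rpow_inv hx.le hc.le (sub_ne_zero.2 ha.symm), Real.rpow_sub hx,
    Real.rpow_one, div_eq_iff (Real.rpow_pos_of_pos hx a).ne']

/-- Section 4.1 (steady state): the limit path `k°(t) = (αβ)^{(1-α^t)/(1-α)} · k₀^{α^t}`
converges, as `t → ∞`, to `k* = (αβ)^{1/(1-α)}`, and `k*` is the unique `k > 0`
with `k = αβ · k^α`. -/
theorem growth_steady_state (α β k₀ : ℝ)
    (hα : α ∈ Set.Ioo (0 : ℝ) 1) (hβ : β ∈ Set.Ioc (0 : ℝ) 1) (hk₀ : 0 < k₀) :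
    Tendsto (fun t : ℕ => (α * β) ^ ((1 - α ^ t) / (1 - α)) * k₀ ^ (α ^ t)) atTop
      (nhds ((α * β) ^ ((1 : ℝ) / (1 - α)))) ∧
    (0 < (α * β) ^ ((1 : ℝ) / (1 - α)) ∧
      (α * β) ^ ((1 : ℝ) / (1 - α))
        = α * β * ((α * β) ^ ((1 : ℝ) / (1 - α))) ^ α) ∧
    ∀ k : ℝ, 0 < k → k = α * β * k ^ α → k = (α * β) ^ ((1 : ℝ) / (1 - α)) := by
  have hc : 0 < α * β := mul_pos hα.1 hβ.1
  have hpos : 0 < (α * β) ^ ((1 : ℝ) / (1 - α)) := Real.rpow_pos_of_pos hc _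
  refine ⟨?_, ⟨hpos, (Real.eq_mul_rpow_self_iff hc hα.2.ne hpos).2 rfl⟩,
    fun k hk => (Real.eq_mul_rpow_self_iff hc hα.2.ne hk).1⟩
  have hpow : Tendsto (fun t : ℕ => α ^ t) atTop (nhds 0) :=
    tendsto_pow_atTop_nhds_zero_of_lt_one hα.1.le hα.2
  have hexp : Tendsto (fun t : ℕ => (1 - α ^ t) / (1 - α)) atTop (nhds (1 / (1 - α))) := by
    simpa using (hpow.const_sub 1).div_const (1 - α)
  simpa using (tendsto_const_nhds.rpow hexp (Or.inl hc.ne')).mul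
    (tendsto_const_nhds.rpow hpow (Or.inl hk₀.ne'))
end

section
/- Let α ∈ (0, 1), β ∈ (0, 1), and k₀ > 0, and define k°(t) = (αβ)^{(1−α^t)/(1−α)} · k₀^{α^t} for t ∈ ℕ. Then k°(T−1)^α − k°(T) > 0 for every T ≥ 1, and lim_{T→∞} [ −β^{T−1} · k°(T) / (k°(T−1)^α − k°(T)) + α·β^T ] = 0. -/
open Filter

/-- The path `a^{(1-α^t)/(1-α)} · k₀^{α^t}` solves the recursion `k(t+1) = a · k(t)^α`. -/
lemma optimal_path_succ {a α k₀ : ℝ} (ha : 0 < a) (hα : α ≠ 1) (hk₀ : 0 < k₀) (t : ℕ) :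
    a ^ ((1 - α ^ (t + 1)) / (1 - α)) * k₀ ^ (α ^ (t + 1)) =
      a * (a ^ ((1 - α ^ t) / (1 - α)) * k₀ ^ (α ^ t)) ^ α := by
  have h1 : 1 - α ≠ 0 := sub_ne_zero.mpr hα.symm
  have hexp : (1 - α ^ (t + 1)) / (1 - α) = 1 + (1 - α ^ t) / (1 - α) * α := by
    field_simp
    ring
  rw [Real.mul_rpow (by positivity) (by positivity), ← Real.rpow_mul ha.le,
    ← Real.rpow_mul hk₀.le, hexp, Real.rpow_add ha, Real.rpow_one, pow_succ, mul_assoc]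

/-- Section 4.1 (transversality for `β < 1`): along the limit path
`k°(t) = (αβ)^{(1-α^t)/(1-α)} · k₀^{α^t}`, the denominator `k°(T-1)^α - k°(T)`
is positive for `T ≥ 1` and the transversality expression
`-β^{T-1} · k°(T) / (k°(T-1)^α - k°(T)) + α β^T` tends to `0`. -/
theorem growth_tvc_discounted (α β k₀ : ℝ)
    (hα : α ∈ Set.Ioo (0 : ℝ) 1) (hβ : β ∈ Set.Ioo (0 : ℝ) 1) (hk₀ : 0 < k₀)
    (ko : ℕ → ℝ)
    (hko : ∀ t : ℕ, ko t = (α * β) ^ ((1 - α ^ t) / (1 - α)) * k₀ ^ (α ^ t)) :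
    (∀ T : ℕ, 1 ≤ T → 0 < (ko (T - 1)) ^ α - ko T) ∧
    Tendsto (fun T : ℕ =>
        -β ^ (T - 1) * ko T / ((ko (T - 1)) ^ α - ko T) + α * β ^ T) atTop
      (nhds 0) := by
  obtain ⟨hα0, hα1⟩ := hα
  obtain ⟨hβ0, hβ1⟩ := hβ
  have hab : 0 < α * β := mul_pos hα0 hβ0
  have hab1 : 0 < 1 - α * β := by nlinarith
  have hpos (t : ℕ) : 0 < ko t ^ α := by
    rw [hko]
    positivity
  have hsucc (t : ℕ) : ko (t + 1) = α * β * ko t ^ α := by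
    rw [hko (t + 1), hko t]
    exact optimal_path_succ hab hα1.ne hk₀ t
  constructor
  · intro T hT
    obtain ⟨t, rfl⟩ := Nat.exists_eq_add_of_le' hT
    rw [Nat.add_sub_cancel, hsucc]
    nlinarith [mul_pos hab1 (hpos t)]
  · rw [← tendsto_add_atTop_iff_nat 1]
    have hlim : Tendsto (fun t : ℕ => (α * β - α * β / (1 - α * β)) * β ^ t) atTop (nhds 0) := by
      simpa using (tendsto_pow_atTop_nhds_zero_of_lt_one hβ0.le hβ1).const_mul
        (α * β - α * β / (1 - α * β))
    refine hlim.congr fun t => ?_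
    have hden : ko t ^ α - α * β * ko t ^ α = (1 - α * β) * ko t ^ α := by ring
    have hne := (hpos t).ne'
    have hne1 := hab1.ne'
    rw [Nat.add_sub_cancel, hsucc, hden]
    field_simp
    ring
end

section
/- Let α ∈ (0, 1) and k₀ > 0, and define k°(t) = α^{(1−α^t)/(1−α)} · k₀^{α^t} for t ∈ ℕ. Then k°(T)^α − k°(T+1) > 0 for every T ∈ ℕ, and lim_{T→∞} k°(T+1) / (k°(T)^α − k°(T+1)) = α/(1−α), which is strictly positive. -/
open Filter

/-- The path `k°` satisfies the growth recursion `k°(t+1) = α · k°(t)^α`. -/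
theorem growth_path_succ {α k : ℝ} (hα : 0 < α) (hα1 : α ≠ 1) (hk : 0 ≤ k) (t : ℕ) :
    α ^ ((1 - α ^ (t + 1)) / (1 - α)) * k ^ (α ^ (t + 1)) =
      α * (α ^ ((1 - α ^ t) / (1 - α)) * k ^ (α ^ t)) ^ α := by
  have h1 : 1 - α ≠ 0 := sub_ne_zero.mpr hα1.symm
  have hexp : (1 - α ^ (t + 1)) / (1 - α) = 1 + (1 - α ^ t) / (1 - α) * α := by
    field_simp
    ring
  rw [Real.mul_rpow (Real.rpow_nonneg hα.le _) (Real.rpow_nonneg hk _),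
    ← Real.rpow_mul hα.le, ← Real.rpow_mul hk, hexp, Real.rpow_add hα, Real.rpow_one,
    pow_succ, mul_assoc]

/-- Section 4.1 (undiscounted case `β = 1`): along the limit path
`k°(t) = α^{(1-α^t)/(1-α)} · k₀^{α^t}`, the quantity `k°(T)^α - k°(T+1)` is
positive and `k°(T+1) / (k°(T)^α - k°(T+1)) → α/(1-α) > 0`, so the
Kamihigashi transversality condition fails. -/
theorem growth_kamihigashi_violated (α k₀ : ℝ)
    (hα : α ∈ Set.Ioo (0 : ℝ) 1) (hk₀ : 0 < k₀)
    (ko : ℕ → ℝ)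
    (hko : ∀ t : ℕ, ko t = α ^ ((1 - α ^ t) / (1 - α)) * k₀ ^ (α ^ t)) :
    (∀ T : ℕ, 0 < (ko T) ^ α - ko (T + 1)) ∧
    Tendsto (fun T : ℕ => ko (T + 1) / ((ko T) ^ α - ko (T + 1))) atTop
      (nhds (α / (1 - α))) ∧
    0 < α / (1 - α) := by
  obtain ⟨hα0, hα1⟩ := hα
  have h1 : 0 < 1 - α := sub_pos.mpr hα1
  have hpos (t : ℕ) : 0 < ko t ^ α := by
    rw [hko]
    positivity
  have hsucc (t : ℕ) : ko (t + 1) = α * ko t ^ α := by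
    rw [hko, hko, growth_path_succ hα0 hα1.ne hk₀.le]
  have hdiff (t : ℕ) : ko t ^ α - ko (t + 1) = (1 - α) * ko t ^ α := by
    rw [hsucc]
    ring
  refine ⟨fun T => ?_, ?_, div_pos hα0 h1⟩
  · rw [hdiff]
    exact mul_pos h1 (hpos T)
  · refine tendsto_const_nhds.congr fun T => ?_
    rw [hdiff, hsucc, mul_div_mul_right _ _ (hpos T).ne']
end
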